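/- Let X/S be a smooth configuration scheme and U ⊆ S open with closed complement Z = S − U. Then: (i) the functors j_!: D^b(coh(X/U)) → D^b(coh(X/S)) and i_*: D^b(coh(X/Z)) → D^b(coh(X/S)) are fully faithful; (ii) D^b(coh(X/Z)) is the right orthogonal to D^b(coh(X/U)) in D^b(coh(X/S)); (iii) D^b(coh(X/U)) is right-admissible in D^b(coh(X/S)), a triangle for F being F_U → F → F_Z. -/

import Mathlib

open CategoryTheory CategoryTheory.Limits

universe w v u

/-- A diagram of categories indexed by a poset `S`: for `β ≤ α`, a transition functor
`φ : C α ⥤ C β`, strictly functorial. -/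
structure PosetDiagram (S : Type) [PartialOrder S] where
  C : S → Type u
  cat : ∀ α, Category.{v} (C α)
  φ : ∀ {α β : S}, β ≤ α → (C α ⥤ C β)
  φ_refl : ∀ α, φ (le_refl α) = 𝟭 (C α)
  φ_trans : ∀ {α β γ : S} (h₁ : β ≤ α) (h₂ : γ ≤ β), φ (h₂.trans h₁) = φ h₁ ⋙ φ h₂

attribute [instance] PosetDiagram.cat

variable {S : Type} [PartialOrder S]

/-- Objects of the poset category `M(S,C)`. -/
structure ConfObj (D : PosetDiagram S) where
  F : ∀ α, D.C α
  σ : ∀ {α β : S} (h : β ≤ α), (D.φ h).obj (F α) ⟶ F β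
  σ_refl : ∀ α, σ (le_refl α) = eqToHom (by rw [D.φ_refl]; rfl)
  σ_trans : ∀ {α β γ : S} (h₁ : β ≤ α) (h₂ : γ ≤ β),
      σ (h₂.trans h₁) = eqToHom (by rw [D.φ_trans h₁ h₂]; rfl) ≫ (D.φ h₂).map (σ h₁) ≫ σ h₂

/-- Morphisms in the poset category `M(S,C)`. -/
@[ext]
structure ConfHom {D : PosetDiagram S} (F G : ConfObj D) where
  f : ∀ α, F.F α ⟶ G.F α
  comm : ∀ {α β : S} (h : β ≤ α), (D.φ h).map (f α) ≫ G.σ h = F.σ h ≫ f β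

/-- The poset category `M(S,C)`. -/
instance confCategory (D : PosetDiagram S) : Category (ConfObj D) where
  Hom F G := ConfHom F G
  id F := ⟨fun _ => 𝟙 _, by intro α β h; simp⟩
  comp u v := ⟨fun α => u.f α ≫ v.f α, by
    intro α β h
    rw [Functor.map_comp, Category.assoc, v.comm h, ← Category.assoc, u.comm h, Category.assoc]⟩
  id_comp u := by apply ConfHom.ext; funext α; exact Category.id_comp _
  comp_id u := by apply ConfHom.ext; funext α; exact Category.comp_id _
  assoc u v w := by apply ConfHom.ext; funext α; exact Category.assoc _ _ _

@[simp] lemma conf_id_f (D : PosetDiagram S) (F : ConfObj D) (α : S) :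
    (𝟙 F : ConfHom F F).f α = 𝟙 (F.F α) := rfl

@[simp] lemma conf_comp_f (D : PosetDiagram S) {F G H : ConfObj D} (u : F ⟶ G) (v : G ⟶ H)
    (α : S) : (u ≫ v).f α = u.f α ≫ v.f α := rfl

/-- The evaluation functor `j_α^* : M(S,C) ⥤ C(α)`. -/
def evalF (D : PosetDiagram S) (α : S) : ConfObj D ⥤ D.C α where
  obj F := F.F α
  map u := u.f α

/-- Restriction of a poset diagram to a subset of the poset. -/
def PosetDiagram.restrict (D : PosetDiagram S) (T : Set S) : PosetDiagram T where
  C t := D.C t.1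
  cat t := D.cat t.1
  φ h := D.φ h
  φ_refl t := D.φ_refl t.1
  φ_trans h₁ h₂ := D.φ_trans h₁ h₂

/-- The restriction functor `M(S,C) ⥤ M(T, C|_T)`. -/
def resF (D : PosetDiagram S) (T : Set S) : ConfObj D ⥤ ConfObj (D.restrict T) where
  obj F :=
    { F := fun t => F.F t.1
      σ := fun h => F.σ h
      σ_refl := fun t => F.σ_refl t.1
      σ_trans := fun h₁ h₂ => F.σ_trans h₁ h₂ }
  map u :=
    { f := fun t => u.f t.1
      comm := fun h => u.comm h }

/-- `F` is supported in `T` if all components outside of `T` vanish. -/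
def SuppIn {D : PosetDiagram S} (F : ConfObj D) (T : Set S) : Prop :=
  ∀ α, α ∉ T → IsZero (F.F α)
open AlgebraicGeometry

universe u'

/-! ### Coherent sheaf data

Mathlib does not yet have the category of coherent sheaves on a scheme, so we axiomatize,
as a structure, the assignment to every scheme `X` of its abelian category `coh X` of
coherent sheaves, together with the (right exact) inverse image functors `f^*`, the
structure sheaves `O_X` and their compatibilities. -/
structure SheafData where
  coh : Scheme.{u'} → Type u
  cat : ∀ X : Scheme, Category.{v} (coh X)
  ab : ∀ X : Scheme, Abelian (coh X)
  pull : ∀ {X Y : Scheme}, (X ⟶ Y) → (coh Y ⥤ coh X)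
  pull_id : ∀ X : Scheme, pull (𝟙 X) = 𝟭 (coh X)
  pull_comp : ∀ {X Y Z : Scheme} (f : X ⟶ Y) (g : Y ⟶ Z), pull (f ≫ g) = pull g ⋙ pull f
  pull_rightExact : ∀ {X Y : Scheme} (f : X ⟶ Y), PreservesFiniteColimits (pull f)
  pull_additive : ∀ {X Y : Scheme} (f : X ⟶ Y), (pull f).Additive
  O : ∀ X : Scheme, coh X
  OIso : ∀ {X Y : Scheme} (f : X ⟶ Y), (pull f).obj (O Y) ≅ O X
  OIso_id : ∀ X : Scheme, (OIso (𝟙 X)).hom = eqToHom (by rw [pull_id]; rfl)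
  OIso_comp : ∀ {X Y Z : Scheme} (f : X ⟶ Y) (g : Y ⟶ Z),
    (OIso (f ≫ g)).hom =
      eqToHom (by rw [pull_comp]; rfl) ≫ (pull f).map (OIso g).hom ≫ (OIso f).hom

attribute [instance] SheafData.cat SheafData.ab

/-! ### Configuration schemes -/

/-- A configuration scheme `X/S`: a contravariant functor from a poset `S` to schemes of
finite type over `ℂ`, all of whose transition morphisms are closed immersions. -/
structure ConfigScheme (S : Type) [PartialOrder S] where
  X : S → Scheme
  toSpec : ∀ α : S, X α ⟶ Spec (CommRingCat.of ℂ)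
  finiteType : ∀ α : S, LocallyOfFiniteType (toSpec α)
  f : ∀ {α β : S}, β ≤ α → (X β ⟶ X α)
  f_refl : ∀ α : S, f (le_refl α) = 𝟙 (X α)
  f_trans : ∀ {α β γ : S} (h₁ : β ≤ α) (h₂ : γ ≤ β), f (h₂.trans h₁) = f h₂ ≫ f h₁
  f_over : ∀ {α β : S} (h : β ≤ α), f h ≫ toSpec α = toSpec β
  f_closed : ∀ {α β : S} (h : β ≤ α), IsClosedImmersion (f h)

/-- A configuration scheme is smooth if all the schemes `X(α)` are smooth over `ℂ`. -/
def ConfigScheme.Smooth {S : Type} [PartialOrder S] (CS : ConfigScheme S) : Prop :=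
  ∀ α : S, AlgebraicGeometry.IsSmooth (CS.toSpec α)

/-- The diagram of categories of coherent sheaves attached to a configuration scheme:
`C(α) = coh(X(α))` with transition functors the inverse images `f_{βα}^*`. -/
def ConfigScheme.diagram {S : Type} [PartialOrder S] (CS : ConfigScheme S)
    (SD : SheafData.{v, u}) : PosetDiagram S where
  C α := SD.coh (CS.X α)
  cat α := SD.cat _
  φ h := SD.pull (CS.f h)
  φ_refl α := by rw [CS.f_refl, SD.pull_id]
  φ_trans h₁ h₂ := by rw [CS.f_trans h₁ h₂, SD.pull_comp]

/-- The category `coh(X/S)` of coherent sheaves on a configuration scheme. -/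
abbrev cohConf {S : Type} [PartialOrder S] (CS : ConfigScheme S) (SD : SheafData.{v, u}) :=
  ConfObj (CS.diagram SD)

lemma SheafData.OIso_congr (SD : SheafData.{v, u}) {X Y : Scheme} {f g : X ⟶ Y} (h : f = g) :
    (SD.OIso f).hom = eqToHom (by rw [h]) ≫ (SD.OIso g).hom := by
  subst h; simp

/-- The structure sheaf `O_{X/S}` of a configuration scheme. -/
def confStructureSheaf {S : Type} [PartialOrder S] (CS : ConfigScheme S)
    (SD : SheafData.{v, u}) : cohConf CS SD where
  F α := SD.O (CS.X α)
  σ h := (SD.OIso (CS.f h)).hom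
  σ_refl α := by
    have key : (SD.OIso (CS.f (le_refl α))).hom =
        eqToHom (by rw [CS.f_refl, SD.pull_id]; rfl) := by
      rw [SD.OIso_congr (CS.f_refl α), SD.OIso_id]
      simp
    exact key
  σ_trans {α β γ} h₁ h₂ := by
    have key : (SD.OIso (CS.f (h₂.trans h₁))).hom =
        eqToHom (by rw [CS.f_trans h₁ h₂, SD.pull_comp]; rfl) ≫
          (SD.pull (CS.f h₂)).map (SD.OIso (CS.f h₁)).hom ≫ (SD.OIso (CS.f h₂)).hom := by
      rw [SD.OIso_congr (CS.f_trans h₁ h₂), SD.OIso_comp]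
      simp
    exact key

/-- The localization functor `coh(X₀) ⥤ coh(X/S)` attached to a compatible family of
(closed immersion) morphisms `t_α : X(α) ⟶ X₀`; it sends `F` to the collection of
inverse images `(t_α^* F)_α`. -/
def locF {S : Type} [PartialOrder S] (CS : ConfigScheme S) (SD : SheafData.{v, u})
    (X₀ : Scheme) (t : ∀ α : S, CS.X α ⟶ X₀)
    (ht : ∀ {α β : S} (h : β ≤ α), CS.f h ≫ t α = t β) :
    SD.coh X₀ ⥤ cohConf CS SD where
  obj F :=
    { F := fun α => (SD.pull (t α)).obj F
      σ := fun {α β} h => eqToHom (by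
        show ((SD.pull (t α)) ⋙ (SD.pull (CS.f h))).obj F = _
        rw [← SD.pull_comp, ht h])
      σ_refl := fun α => rfl
      σ_trans := fun {α β γ} h₁ h₂ => by
        have hF : ∀ {α β : S} (h : β ≤ α),
            (SD.pull (CS.f h)).obj ((SD.pull (t α)).obj F) = (SD.pull (t β)).obj F := by
          intro α β h
          show ((SD.pull (t α)) ⋙ (SD.pull (CS.f h))).obj F = _
          rw [← SD.pull_comp, ht h]
        have hc : (SD.pull (CS.f (h₂.trans h₁))).obj ((SD.pull (t α)).obj F) =
            (SD.pull (CS.f h₂)).obj ((SD.pull (CS.f h₁)).obj ((SD.pull (t α)).obj F)) := by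
          rw [CS.f_trans h₁ h₂, SD.pull_comp]; rfl
        have key : eqToHom (hF (h₂.trans h₁)) =
            eqToHom hc ≫ (SD.pull (CS.f h₂)).map (eqToHom (hF h₁)) ≫ eqToHom (hF h₂) := by
          simp [eqToHom_map]
        exact key }
  map u :=
    { f := fun α => (SD.pull (t α)).map u
      comm := fun {α β} h => by
        have hF : SD.pull (t α) ⋙ SD.pull (CS.f h) = SD.pull (t β) := by
          rw [← SD.pull_comp, ht h]
        have key : (SD.pull (t α) ⋙ SD.pull (CS.f h)).map u ≫ eqToHom (Functor.congr_obj hF _) =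
            eqToHom (Functor.congr_obj hF _) ≫ (SD.pull (t β)).map u := by
          rw [Functor.congr_hom hF u]
          simp
        exact key }
  map_id F := by apply ConfHom.ext; funext α; exact (SD.pull (t α)).map_id F
  map_comp u v := by apply ConfHom.ext; funext α; exact (SD.pull (t α)).map_comp u v

attribute [local instance] MvPolynomial.gradedAlgebra

/-- Projective space `ℙ^n` over `ℂ`, as `Proj` of a graded polynomial ring. -/
noncomputable def ProjSpaceC (n : ℕ) : Scheme :=
  AlgebraicGeometry.Proj (MvPolynomial.homogeneousSubmodule (Fin (n + 1)) ℂ)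

/-- A scheme is a projective variety over `ℂ` if it is integral and admits a closed
immersion into some projective space over `ℂ`. -/
def IsProjectiveVariety (X : Scheme) : Prop :=
  IsIntegral X ∧ ∃ (n : ℕ) (i : X ⟶ ProjSpaceC n), IsClosedImmersion i
section DerivedPreamble

variable (A : Type u) [Category.{v} A] [Abelian A] [HasDerivedCategory.{w} A]

/-- An object of the derived category is (cohomologically) bounded. -/
def BoundedObj (X : DerivedCategory A) : Prop :=
  ∃ a b : ℤ, ∀ i : ℤ, (i < a ∨ b < i) → IsZero ((DerivedCategory.homologyFunctor A i).obj X)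

/-- The bounded derived category `D^b(A)`, realized as the full subcategory of
cohomologically bounded objects of the derived category. -/
abbrev Db := ObjectProperty.FullSubcategory (BoundedObj A)

variable {A}

lemma boundedObj_single (X : A) :
    BoundedObj A ((DerivedCategory.singleFunctor A 0).obj X) := by
  refine ⟨0, 0, fun i hi => ?_⟩
  have hne : i ≠ 0 := by rcases hi with h | h <;> omega
  have e : (DerivedCategory.homologyFunctor A i).obj
      ((DerivedCategory.singleFunctor A 0).obj X) ≅
      ((HomologicalComplex.single A (ComplexShape.up ℤ) 0).obj X).homology i :=
    (DerivedCategory.homologyFunctor A i).mapIso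
      ((DerivedCategory.quotientCompQhIso A).app
        ((HomologicalComplex.single A (ComplexShape.up ℤ) 0).obj X)) ≪≫
      (DerivedCategory.homologyFunctorFactors A i).app _
  exact (HomologicalComplex.isZero_single_obj_homology _ 0 X i hne).of_iso e

variable (A)

/-- The canonical functor `A ⥤ D^b(A)` sending `X` to the complex concentrated in degree 0. -/
noncomputable def toDb : A ⥤ Db A :=
  ObjectProperty.lift _ (DerivedCategory.singleFunctor A 0) boundedObj_single

end DerivedPreamble

open CategoryTheory.Pretriangulated

section DerivedFunctors

variable {A : Type*} [Category* A] [Abelian A] [HasDerivedCategory A]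
  {B : Type*} [Category* B] [Abelian B] [HasDerivedCategory B]

section

variable (F : A ⥤ B) [F.Additive] [PreservesFiniteLimits F] [PreservesFiniteColimits F]

/-- Exact functors commute with the cohomology of objects of the derived category. -/
noncomputable def homologyMapDerivedCategoryIso (n : ℤ) (X : DerivedCategory A) :
    (DerivedCategory.homologyFunctor B n).obj (F.mapDerivedCategory.obj X) ≅
      F.obj ((DerivedCategory.homologyFunctor A n).obj X) :=
  let K := DerivedCategory.Q.objPreimage X
  let e : DerivedCategory.Q.obj K ≅ X := DerivedCategory.Q.objObjPreimageIso X
  (DerivedCategory.homologyFunctor B n).mapIso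
      (F.mapDerivedCategory.mapIso e.symm ≪≫ F.mapDerivedCategoryFactors.app K) ≪≫
    (DerivedCategory.homologyFunctorFactors B n).app _ ≪≫
    (K.sc n).mapHomologyIso F ≪≫
    F.mapIso (((DerivedCategory.homologyFunctorFactors A n).app K).symm ≪≫
      (DerivedCategory.homologyFunctor A n).mapIso e)

lemma boundedObj_mapDerivedCategory {X : DerivedCategory A} (hX : BoundedObj A X) :
    BoundedObj B (F.mapDerivedCategory.obj X) := by
  obtain ⟨a, b, h⟩ := hX
  exact ⟨a, b, fun i hi =>
    (F.map_isZero (h i hi)).of_iso (homologyMapDerivedCategoryIso F i X)⟩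

/-- The functor induced on bounded derived categories by an exact functor. -/
noncomputable def mapDb : Db A ⥤ Db B :=
  ObjectProperty.lift _ (ObjectProperty.ι _ ⋙ F.mapDerivedCategory)
    fun X => boundedObj_mapDerivedCategory F X.property

instance full_mapDb [F.mapDerivedCategory.Full] : (mapDb F).Full := by
  unfold mapDb; infer_instance

instance faithful_mapDb [F.mapDerivedCategory.Faithful] : (mapDb F).Faithful := by
  unfold mapDb; infer_instance

/-- `mapDb F` extends `F`. -/
noncomputable def toDbCompMapDb : toDb A ⋙ mapDb F ≅ F ⋙ toDb B :=
  NatIso.ofComponents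
    (fun X => ObjectProperty.isoMk _ ((F.mapDerivedCategorySingleFunctor 0).app X))
    fun f => ObjectProperty.hom_ext _ ((F.mapDerivedCategorySingleFunctor 0).hom.naturality f)

end

open scoped ZeroObject in
lemma isZero_of_isZero_homology {X : DerivedCategory A}
    (h : ∀ n, IsZero ((DerivedCategory.homologyFunctor A n).obj X)) : IsZero X := by
  have : IsIso (0 : X ⟶ 0) := by
    rw [DerivedCategory.isIso_iff]
    intro n
    exact isIso_of_source_target_iso_zero _ (h n).isoZero
      ((DerivedCategory.homologyFunctor A n).map_isZero (isZero_zero _)).isoZero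
  exact (isZero_zero _).of_iso (asIso (0 : X ⟶ 0))

lemma isZero_mapDerivedCategory_iff (F : A ⥤ B) [F.Additive] [PreservesFiniteLimits F]
    [PreservesFiniteColimits F] (X : DerivedCategory A) :
    IsZero (F.mapDerivedCategory.obj X) ↔
      ∀ n, IsZero (F.obj ((DerivedCategory.homologyFunctor A n).obj X)) :=
  ⟨fun h n => ((DerivedCategory.homologyFunctor B n).map_isZero h).of_iso
      (homologyMapDerivedCategoryIso F n X).symm,
    fun h => isZero_of_isZero_homology fun n =>
      (h n).of_iso (homologyMapDerivedCategoryIso F n X)⟩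

/-- The cone of a morphism of bounded objects is bounded. -/
lemma boundedObj_obj₃ {T : Triangle (DerivedCategory A)} (hT : T ∈ distTriang _)
    (h₁ : BoundedObj A T.obj₁) (h₂ : BoundedObj A T.obj₂) : BoundedObj A T.obj₃ := by
  obtain ⟨a, b, h₁⟩ := h₁
  obtain ⟨c, d, h₂⟩ := h₂
  refine ⟨min (a - 1) c, max b d, fun i hi => ?_⟩
  exact (DerivedCategory.HomologySequence.exact₃ T hT i (i + 1) rfl).isZero_of_both_zeros
    ((h₂ i (by omega)).eq_of_src _ _) ((h₁ (i + 1) (by omega)).eq_of_tgt _ _)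

section

variable {L : A ⥤ B} {R : B ⥤ A} (adj : L ⊣ R) [L.Additive] [R.Additive]

/-- The adjunction on categories of complexes induced by an adjunction of additive functors. -/
noncomputable def mapHomologicalComplexAdjunction :
    L.mapHomologicalComplex (ComplexShape.up ℤ) ⊣ R.mapHomologicalComplex (ComplexShape.up ℤ) where
  unit :=
    { app := fun K =>
        { f := fun i => adj.unit.app (K.X i)
          comm' := fun _ _ _ => (adj.unit.naturality _).symm }
      naturality := fun _ _ f =>
        HomologicalComplex.hom_ext _ _ fun i => adj.unit.naturality (f.f i) }
  counit :=
    { app := fun K =>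
        { f := fun i => adj.counit.app (K.X i)
          comm' := fun _ _ _ => (adj.counit.naturality _).symm }
      naturality := fun _ _ f =>
        HomologicalComplex.hom_ext _ _ fun i => adj.counit.naturality (f.f i) }
  left_triangle_components K :=
    HomologicalComplex.hom_ext _ _ fun i => adj.left_triangle_components (K.X i)
  right_triangle_components K :=
    HomologicalComplex.hom_ext _ _ fun i => adj.right_triangle_components (K.X i)

variable [PreservesFiniteLimits L] [PreservesFiniteColimits L]
  [PreservesFiniteLimits R] [PreservesFiniteColimits R]

noncomputable instance (F : A ⥤ B) [F.Additive] [PreservesFiniteLimits F]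
    [PreservesFiniteColimits F] :
    CatCommSq (F.mapHomologicalComplex (ComplexShape.up ℤ)) DerivedCategory.Q DerivedCategory.Q
      F.mapDerivedCategory :=
  ⟨F.mapDerivedCategoryFactors.symm⟩

/-- The adjunction on derived categories induced by an adjunction of exact functors. -/
noncomputable def mapDerivedCategoryAdjunction : L.mapDerivedCategory ⊣ R.mapDerivedCategory :=
  (mapHomologicalComplexAdjunction adj).localization
    DerivedCategory.Q (HomologicalComplex.quasiIso A (ComplexShape.up ℤ))
    DerivedCategory.Q (HomologicalComplex.quasiIso B (ComplexShape.up ℤ)) _ _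

instance isIso_unit_mapDerivedCategoryAdjunction [IsIso adj.unit] :
    IsIso (mapDerivedCategoryAdjunction adj).unit := by
  have h (K : CochainComplex A ℤ) :
      IsIso ((mapDerivedCategoryAdjunction adj).unit.app (DerivedCategory.Q.obj K)) := by
    have : ∀ i, IsIso (((mapHomologicalComplexAdjunction adj).unit.app K).f i) := fun i =>
      inferInstanceAs (IsIso (adj.unit.app (K.X i)))
    have : IsIso ((mapHomologicalComplexAdjunction adj).unit.app K) :=
      HomologicalComplex.Hom.isIso_of_components _
    rw [mapDerivedCategoryAdjunction, Adjunction.localization_unit_app]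
    infer_instance
  have (X : DerivedCategory A) : IsIso ((mapDerivedCategoryAdjunction adj).unit.app X) :=
    ((NatTrans.isIso_app_iff_of_iso _ (DerivedCategory.Q.objObjPreimageIso X)).1 (h _))
  exact NatIso.isIso_of_isIso_app _

instance isIso_counit_mapDerivedCategoryAdjunction [IsIso adj.counit] :
    IsIso (mapDerivedCategoryAdjunction adj).counit := by
  have h (K : CochainComplex B ℤ) :
      IsIso ((mapDerivedCategoryAdjunction adj).counit.app (DerivedCategory.Q.obj K)) := by
    have : ∀ i, IsIso (((mapHomologicalComplexAdjunction adj).counit.app K).f i) := fun i =>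
      inferInstanceAs (IsIso (adj.counit.app (K.X i)))
    have : IsIso ((mapHomologicalComplexAdjunction adj).counit.app K) :=
      HomologicalComplex.Hom.isIso_of_components _
    rw [mapDerivedCategoryAdjunction, Adjunction.localization_counit_app]
    infer_instance
  have (X : DerivedCategory B) : IsIso ((mapDerivedCategoryAdjunction adj).counit.app X) :=
    ((NatTrans.isIso_app_iff_of_iso _ (DerivedCategory.Q.objObjPreimageIso X)).1 (h _))
  exact NatIso.isIso_of_isIso_app _

end

/-- Let `L ⊣ R` be exact functors with `R L = id`, and let `P` be an exact functor which kills the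
image of `L` and is such that `R` and `P` jointly detect zero objects. Then `R` detects the right
orthogonal of the kernel of `P` on bounded derived categories, and every object is an extension
of an object of this orthogonal by an object of the kernel. -/
theorem Db_orthogonal_and_admissible
    {E : Type*} [Category* E] [Abelian E] [HasDerivedCategory E]
    {L : A ⥤ B} {R : B ⥤ A} (adj : L ⊣ R) [IsIso adj.unit] (P : B ⥤ E)
    [L.Additive] [R.Additive] [P.Additive]
    [PreservesFiniteLimits L] [PreservesFiniteColimits L]
    [PreservesFiniteLimits R] [PreservesFiniteColimits R]
    [PreservesFiniteLimits P] [PreservesFiniteColimits P]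
    (hLP : ∀ X, IsZero (P.obj (L.obj X)))
    (hRP : ∀ Y, IsZero (R.obj Y) → IsZero (P.obj Y) → IsZero Y) :
    (∀ X : Db B,
      (∀ Y : Db B, (∀ n, IsZero (P.obj ((DerivedCategory.homologyFunctor B n).obj Y.obj))) →
        Subsingleton (Y ⟶ X)) ↔
      ∀ n, IsZero (R.obj ((DerivedCategory.homologyFunctor B n).obj X.obj))) ∧
    (∀ X : Db B,
      ∃ (Y Z : Db B) (f : Y.obj ⟶ X.obj) (g : X.obj ⟶ Z.obj) (h : Z.obj ⟶ Y.obj⟦(1 : ℤ)⟧),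
        (Triangle.mk f g h ∈ distTriang (DerivedCategory B)) ∧
        (∀ n, IsZero (P.obj ((DerivedCategory.homologyFunctor B n).obj Y.obj))) ∧
        (∀ n, IsZero (R.obj ((DerivedCategory.homologyFunctor B n).obj Z.obj)))) := by
  let adj' := mapDerivedCategoryAdjunction adj
  have hLP' (X : DerivedCategory A) :
      ∀ n, IsZero (P.obj ((DerivedCategory.homologyFunctor B n).obj
        (L.mapDerivedCategory.obj X))) := fun n =>
    (hLP _).of_iso (P.mapIso (homologyMapDerivedCategoryIso L n X))
  have isIso_map_counit (X : DerivedCategory B) :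
      IsIso (R.mapDerivedCategory.map (adj'.counit.app X)) := by
    have h := adj'.right_triangle_components X
    have : IsIso (adj'.unit.app (R.mapDerivedCategory.obj X)) := by
      dsimp only [adj']; infer_instance
    exact IsIso.of_isIso_fac_left h
  have cone (X : DerivedCategory B) {T : Triangle (DerivedCategory B)} (hT : T ∈ distTriang _)
      (hX : IsIso (R.mapDerivedCategory.map T.mor₁)) :
      IsZero (R.mapDerivedCategory.obj T.obj₃) :=
    Triangle.isZero₃_of_isIso₁ _ (R.mapDerivedCategory.map_distinguished T hT) hX
  have isIso_counit (Y : DerivedCategory B)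
      (hY : ∀ n, IsZero (P.obj ((DerivedCategory.homologyFunctor B n).obj Y))) :
      IsIso (adj'.counit.app Y) := by
    obtain ⟨Z, g, h, hT⟩ := distinguished_cocone_triangle (adj'.counit.app Y)
    have hR := cone Y hT (isIso_map_counit Y)
    have hP : IsZero (P.mapDerivedCategory.obj Z) :=
      Triangle.isZero₃_of_isZero₁₂ _ (P.mapDerivedCategory.map_distinguished _ hT)
        ((isZero_mapDerivedCategory_iff P _).2 (hLP' _))
        ((isZero_mapDerivedCategory_iff P _).2 hY)
    exact (Triangle.isZero₃_iff_isIso₁ _ hT).1 (isZero_of_isZero_homology fun n =>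
      hRP _ ((isZero_mapDerivedCategory_iff R _).1 hR n)
        ((isZero_mapDerivedCategory_iff P _).1 hP n))
  have bounded (X : Db B) :
      BoundedObj B (L.mapDerivedCategory.obj (R.mapDerivedCategory.obj X.obj)) :=
    boundedObj_mapDerivedCategory L (boundedObj_mapDerivedCategory R X.property)
  refine ⟨fun X => ⟨fun h => ?_, fun h Y hY => ⟨fun f g => ?_⟩⟩, fun X => ?_⟩
  · rw [← isZero_mapDerivedCategory_iff R]
    have := h ⟨_, bounded X⟩ (hLP' _)
    rw [IsZero.iff_id_eq_zero]
    apply (adj'.homEquiv _ _).symm.injective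
    exact congrArg (fun f => f.hom) (this.elim (ObjectProperty.homMk _) (ObjectProperty.homMk _))
  · rw [← isZero_mapDerivedCategory_iff R] at h
    have := isIso_counit Y.obj hY
    apply ObjectProperty.hom_ext
    rw [← cancel_epi (adj'.counit.app Y.obj)]
    exact (adj'.homEquiv _ _).injective (h.eq_of_tgt _ _)
  · obtain ⟨Z, g, h, hT⟩ := distinguished_cocone_triangle (adj'.counit.app X.obj)
    exact ⟨⟨_, bounded X⟩, ⟨Z, boundedObj_obj₃ hT (bounded X) X.property⟩, _, g, h, hT, hLP' _,
      (isZero_mapDerivedCategory_iff R _).1 (cone X.obj hT (isIso_map_counit X.obj))⟩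

end DerivedFunctors

section ConfigurationCategories

variable {D : PosetDiagram S}

lemma PosetDiagram.φ_refl_map (D : PosetDiagram S) (α : S) {X Y : D.C α} (f : X ⟶ Y) :
    (D.φ (le_refl α)).map f = eqToHom (by rw [D.φ_refl]; rfl) ≫ f ≫
      eqToHom (by rw [D.φ_refl]; rfl) :=
  Functor.congr_hom (D.φ_refl α) f

lemma PosetDiagram.φ_trans_map (D : PosetDiagram S) {α β γ : S} (h₁ : β ≤ α) (h₂ : γ ≤ β)
    {X Y : D.C α} (f : X ⟶ Y) :
    (D.φ (h₂.trans h₁)).map f = eqToHom (by rw [D.φ_trans h₁ h₂]; rfl) ≫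
      (D.φ h₂).map ((D.φ h₁).map f) ≫ eqToHom (by rw [D.φ_trans h₁ h₂]; rfl) :=
  Functor.congr_hom (D.φ_trans h₁ h₂) f

section Limits

variable {J : Type} [SmallCategory J] (K : J ⥤ ConfObj D)

/-- The component at `α` of a diagram in `ConfObj D`. -/
abbrev confComponent (α : S) : J ⥤ D.C α where
  obj j := (K.obj j).F α
  map u := (K.map u).f α
  map_id j := by rw [K.map_id]; rfl
  map_comp u v := by rw [K.map_comp]; rfl

section

variable [∀ α, HasLimitsOfShape J (D.C α)]

/-- The transition morphisms of the pointwise limit. -/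
noncomputable def confLimitσ {α β : S} (h : β ≤ α) :
    (D.φ h).obj (limit (confComponent K α)) ⟶ limit (confComponent K β) :=
  limit.lift (confComponent K β)
    { pt := (D.φ h).obj (limit (confComponent K α))
      π :=
        { app := fun j => (D.φ h).map (limit.π (confComponent K α) j) ≫ (K.obj j).σ h
          naturality := fun i j u => by
            have h₁ := limit.w (confComponent K α) u
            have h₂ := (K.map u).comm h
            dsimp only at h₁
            dsimp only [Functor.const_obj_map]
            rw [← h₁, Functor.map_comp, Category.assoc, Category.assoc, h₂]
            exact Category.id_comp _ } }

lemma confLimitσ_π {α β : S} (h : β ≤ α) (j : J) :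
    confLimitσ K h ≫ limit.π (confComponent K β) j =
      (D.φ h).map (limit.π (confComponent K α) j) ≫ (K.obj j).σ h :=
  limit.lift_π _ j

/-- The pointwise limit of a diagram in `ConfObj D`. -/
noncomputable def confLimitCone : Cone K where
  pt :=
    { F := fun α => limit (confComponent K α)
      σ := fun {α β} h => confLimitσ K h
      σ_refl := fun α => by
        apply limit.hom_ext
        intro j
        rw [confLimitσ_π, D.φ_refl_map, (K.obj j).σ_refl]
        simp
      σ_trans := fun {α β γ} h₁ h₂ => by
        apply limit.hom_ext
        intro j
        simp only [Category.assoc]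
        rw [confLimitσ_π, confLimitσ_π, ← Functor.map_comp_assoc, confLimitσ_π,
          (K.obj j).σ_trans h₁ h₂, D.φ_trans_map h₁ h₂]
        simp }
  π :=
    { app := fun j =>
        { f := fun α => limit.π (confComponent K α) j
          comm := fun {α β} h => (confLimitσ_π K h j).symm }
      naturality := fun i j u => by
        apply ConfHom.ext
        funext α
        exact (limit.cone (confComponent K α)).π.naturality u }

/-- The component at `α` of a cone in `ConfObj D`. -/
abbrev confComponentCone {K : J ⥤ ConfObj D} (s : Cone K) (α : S) : Cone (confComponent K α) where
  pt := s.pt.F α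
  π :=
    { app := fun j => (s.π.app j).f α
      naturality := fun _ _ u => congrArg (fun f => f.f α) (s.π.naturality u) }

/-- The pointwise limit is a limit. -/
noncomputable def confLimitConeIsLimit : IsLimit (confLimitCone K) where
  lift s :=
    { f := fun α => limit.lift (confComponent K α) (confComponentCone s α)
      comm := fun {α β} h => by
        apply limit.hom_ext
        intro j
        dsimp only [confLimitCone]
        rw [Category.assoc, Category.assoc, confLimitσ_π, limit.lift_π,
          ← Functor.map_comp_assoc, limit.lift_π]
        exact (s.π.app j).comm h }
  fac s j := by
    apply ConfHom.ext
    funext α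
    exact limit.lift_π _ j
  uniq s m hm := by
    apply ConfHom.ext
    funext α
    apply limit.hom_ext
    intro j
    rw [limit.lift_π]
    exact congrArg (fun f => f.f α) (hm j)

instance evalF_preservesLimitsOfShape (α : S) : PreservesLimitsOfShape J (evalF D α) :=
  ⟨fun {K} => preservesLimit_of_preserves_limit_cone (confLimitConeIsLimit K)
    (limit.isLimit (confComponent K α))⟩

end

section

variable [∀ α, HasColimitsOfShape J (D.C α)]
  [∀ {α β : S} (h : β ≤ α), PreservesColimitsOfShape J (D.φ h)]

/-- The transition functors preserve the pointwise colimits. -/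
noncomputable def confColimitIsColimit {α β : S} (h : β ≤ α) :
    IsColimit ((D.φ h).mapCocone (colimit.cocone (confComponent K α))) :=
  isColimitOfPreserves (D.φ h) (colimit.isColimit (confComponent K α))

/-- The transition morphisms of the pointwise colimit. -/
noncomputable def confColimitσ {α β : S} (h : β ≤ α) :
    (D.φ h).obj (colimit (confComponent K α)) ⟶ colimit (confComponent K β) :=
  (confColimitIsColimit K h).desc
    { pt := colimit (confComponent K β)
      ι :=
        { app := fun j => (K.obj j).σ h ≫ colimit.ι (confComponent K β) j
          naturality := fun i j u => by
            have h₁ := colimit.w (confComponent K β) u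
            have h₂ := (K.map u).comm h
            dsimp only at h₁
            dsimp only [Functor.comp_map, Functor.const_obj_map]
            rw [← h₁, ← Category.assoc, h₂, Category.assoc]
            exact (Category.comp_id _).symm } }

lemma ι_confColimitσ {α β : S} (h : β ≤ α) (j : J) :
    (D.φ h).map (colimit.ι (confComponent K α) j) ≫ confColimitσ K h =
      (K.obj j).σ h ≫ colimit.ι (confComponent K β) j :=
  (confColimitIsColimit K h).fac _ j

lemma confColimit_hom_ext {α β : S} (h : β ≤ α) {Y : D.C β}
    {f g : (D.φ h).obj (colimit (confComponent K α)) ⟶ Y}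
    (w : ∀ j, (D.φ h).map (colimit.ι (confComponent K α) j) ≫ f =
      (D.φ h).map (colimit.ι (confComponent K α) j) ≫ g) : f = g :=
  (confColimitIsColimit K h).hom_ext w

/-- The pointwise colimit of a diagram in `ConfObj D`. -/
noncomputable def confColimitCocone : Cocone K where
  pt :=
    { F := fun α => colimit (confComponent K α)
      σ := fun {α β} h => confColimitσ K h
      σ_refl := fun α => by
        apply confColimit_hom_ext
        intro j
        rw [ι_confColimitσ, D.φ_refl_map, (K.obj j).σ_refl]
        simp
      σ_trans := fun {α β γ} h₁ h₂ => by
        apply confColimit_hom_ext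
        intro j
        rw [ι_confColimitσ, D.φ_trans_map h₁ h₂, (K.obj j).σ_trans h₁ h₂]
        simp only [Category.assoc, eqToHom_trans_assoc, eqToHom_refl, Category.id_comp]
        rw [← Functor.map_comp_assoc, ι_confColimitσ, Functor.map_comp, Category.assoc,
          ι_confColimitσ] }
  ι :=
    { app := fun j =>
        { f := fun α => colimit.ι (confComponent K α) j
          comm := fun {α β} h => ι_confColimitσ K h j }
      naturality := fun i j u => by
        apply ConfHom.ext
        funext α
        exact (colimit.cocone (confComponent K α)).ι.naturality u }

/-- The component at `α` of a cocone in `ConfObj D`. -/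
abbrev confComponentCocone {K : J ⥤ ConfObj D} (s : Cocone K) (α : S) :
    Cocone (confComponent K α) where
  pt := s.pt.F α
  ι :=
    { app := fun j => (s.ι.app j).f α
      naturality := fun _ _ u => congrArg (fun f => f.f α) (s.ι.naturality u) }

/-- The pointwise colimit is a colimit. -/
noncomputable def confColimitCoconeIsColimit : IsColimit (confColimitCocone K) where
  desc s :=
    { f := fun α => colimit.desc (confComponent K α) (confComponentCocone s α)
      comm := fun {α β} h => by
        apply confColimit_hom_ext
        intro j
        dsimp only [confColimitCocone]
        rw [← Category.assoc, ← Category.assoc, ι_confColimitσ, ← Functor.map_comp, Category.assoc,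
          colimit.ι_desc, colimit.ι_desc]
        exact (s.ι.app j).comm h }
  fac s j := by
    apply ConfHom.ext
    funext α
    exact colimit.ι_desc _ j
  uniq s m hm := by
    apply ConfHom.ext
    funext α
    apply colimit.hom_ext
    intro j
    rw [colimit.ι_desc]
    exact congrArg (fun f => f.f α) (hm j)

instance evalF_preservesColimitsOfShape (α : S) : PreservesColimitsOfShape J (evalF D α) :=
  ⟨fun {K} => preservesColimit_of_preserves_colimit_cocone (confColimitCoconeIsColimit K)
    (colimit.isColimit (confComponent K α))⟩

end

end Limits

variable (D) in
lemma evalF_jointlyReflectIsomorphisms : JointlyReflectIsomorphisms (evalF D) where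
  isIso {F G} f hf := by
    have hf' (α : S) : IsIso (f.f α) := hf α
    let g (α : S) : G.F α ⟶ F.F α := inv (f.f α)
    have hfg (α : S) : f.f α ≫ g α = 𝟙 _ := IsIso.hom_inv_id (f.f α)
    have hgf (α : S) : g α ≫ f.f α = 𝟙 _ := IsIso.inv_hom_id (f.f α)
    refine ⟨{ f := g, comm := fun {α β} h => ?_ }, ?_, ?_⟩
    · calc (D.φ h).map (g α) ≫ F.σ h
          = (D.φ h).map (g α) ≫ (F.σ h ≫ f.f β) ≫ g β := by rw [Category.assoc, hfg]; simp
        _ = G.σ h ≫ g β := by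
          rw [← f.comm h, Category.assoc, ← Functor.map_comp_assoc, hgf]; simp
    · exact ConfHom.ext (funext hfg)
    · exact ConfHom.ext (funext hgf)

section

variable [∀ α, Abelian (D.C α)]

lemma preservesFiniteLimits_of_comp_evalF {E : Type*} [Category* E] (T : E ⥤ ConfObj D)
    (h : ∀ α, PreservesFiniteLimits (T ⋙ evalF D α)) : PreservesFiniteLimits T where
  preservesFiniteLimits J _ _ :=
    ⟨fun {K} => ⟨fun {c} hc => by
      have : HasLimit (K ⋙ T) := ⟨_, confLimitConeIsLimit (K ⋙ T)⟩
      exact ⟨(evalF_jointlyReflectIsomorphisms D).jointlyReflectsLimit fun α =>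
        isLimitOfPreserves (T ⋙ evalF D α) hc⟩⟩⟩

variable [∀ {α β : S} (h : β ≤ α), PreservesFiniteColimits (D.φ h)]

lemma preservesFiniteColimits_of_comp_evalF {E : Type*} [Category* E] (T : E ⥤ ConfObj D)
    (h : ∀ α, PreservesFiniteColimits (T ⋙ evalF D α)) : PreservesFiniteColimits T where
  preservesFiniteColimits J _ _ :=
    ⟨fun {K} => ⟨fun {c} hc => by
      have : HasColimit (K ⋙ T) := ⟨_, confColimitCoconeIsColimit (K ⋙ T)⟩
      exact ⟨(evalF_jointlyReflectIsomorphisms D).jointlyReflectsColimit fun α =>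
        isColimitOfPreserves (T ⋙ evalF D α) hc⟩⟩⟩

instance evalF_preservesFiniteLimits (α : S) : PreservesFiniteLimits (evalF D α) :=
  ⟨fun _ _ _ => inferInstance⟩

instance evalF_preservesFiniteColimits (α : S) : PreservesFiniteColimits (evalF D α) :=
  ⟨fun _ _ _ => inferInstance⟩

end

section Extension

variable {T : Set S}

/-- The component at `α ∈ T` of an object of the restricted category. -/
def restrictObj (X : ConfObj (D.restrict T)) (α : S) (hα : α ∈ T) : D.C α := X.F ⟨α, hα⟩

/-- The transition morphisms of an object of the restricted category. -/
def restrictσ (X : ConfObj (D.restrict T)) {α β : S} (h : β ≤ α) (hα : α ∈ T) (hβ : β ∈ T) :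
    (D.φ h).obj (restrictObj X α hα) ⟶ restrictObj X β hβ :=
  X.σ (α := ⟨α, hα⟩) (β := ⟨β, hβ⟩) h

lemma restrictσ_refl (X : ConfObj (D.restrict T)) (α : S) (hα : α ∈ T) :
    restrictσ X (le_refl α) hα hα = eqToHom (by rw [D.φ_refl]; rfl) :=
  X.σ_refl ⟨α, hα⟩

lemma restrictσ_trans (X : ConfObj (D.restrict T)) {α β γ : S} (h₁ : β ≤ α) (h₂ : γ ≤ β)
    (hα : α ∈ T) (hβ : β ∈ T) (hγ : γ ∈ T) :
    restrictσ X (h₂.trans h₁) hα hγ = eqToHom (by rw [D.φ_trans h₁ h₂]; rfl) ≫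
      (D.φ h₂).map (restrictσ X h₁ hα hβ) ≫ restrictσ X h₂ hβ hγ :=
  X.σ_trans (α := ⟨α, hα⟩) (β := ⟨β, hβ⟩) (γ := ⟨γ, hγ⟩) h₁ h₂

/-- The component at `α ∈ T` of a morphism of the restricted category. -/
def restrictHom {X Y : ConfObj (D.restrict T)} (f : X ⟶ Y) (α : S) (hα : α ∈ T) :
    restrictObj X α hα ⟶ restrictObj Y α hα :=
  f.f ⟨α, hα⟩

lemma restrictHom_comm {X Y : ConfObj (D.restrict T)} (f : X ⟶ Y) {α β : S} (h : β ≤ α)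
    (hα : α ∈ T) (hβ : β ∈ T) :
    (D.φ h).map (restrictHom f α hα) ≫ restrictσ Y h hα hβ =
      restrictσ X h hα hβ ≫ restrictHom f β hβ :=
  f.comm (α := ⟨α, hα⟩) (β := ⟨β, hβ⟩) h

lemma restrictHom_id (X : ConfObj (D.restrict T)) (α : S) (hα : α ∈ T) :
    restrictHom (𝟙 X) α hα = 𝟙 _ := rfl

lemma restrictHom_comp {X Y Z : ConfObj (D.restrict T)} (f : X ⟶ Y) (g : Y ⟶ Z) (α : S)
    (hα : α ∈ T) : restrictHom (f ≫ g) α hα = restrictHom f α hα ≫ restrictHom g α hα := rfl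

variable [∀ α, Abelian (D.C α)]

open Classical ZeroObject in
/-- The components of the extension by zero. -/
noncomputable def extObj (X : ConfObj (D.restrict T)) (α : S) : D.C α :=
  if h : α ∈ T then restrictObj X α h else 0

/-- The extension by zero does not change the components in `T`. -/
noncomputable def extIso (X : ConfObj (D.restrict T)) (α : S) (h : α ∈ T) :
    extObj X α ≅ restrictObj X α h :=
  eqToIso (dif_pos h)

lemma isZero_extObj (X : ConfObj (D.restrict T)) (α : S) (h : α ∉ T) : IsZero (extObj X α) := by
  rw [extObj, dif_neg h]
  exact isZero_zero _

open Classical in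
/-- The transition morphisms of the extension by zero. -/
noncomputable def extσ (X : ConfObj (D.restrict T)) {α β : S} (h : β ≤ α) :
    (D.φ h).obj (extObj X α) ⟶ extObj X β :=
  if H : α ∈ T ∧ β ∈ T then
    (D.φ h).map (extIso X α H.1).hom ≫ restrictσ X h H.1 H.2 ≫ (extIso X β H.2).inv
  else 0

lemma extσ_of_mem (X : ConfObj (D.restrict T)) {α β : S} (h : β ≤ α) (hα : α ∈ T) (hβ : β ∈ T) :
    extσ X h = (D.φ h).map (extIso X α hα).hom ≫ restrictσ X h hα hβ ≫ (extIso X β hβ).inv :=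
  dif_pos ⟨hα, hβ⟩

open Classical in
/-- The components of the extension by zero of a morphism. -/
noncomputable def extHom {X Y : ConfObj (D.restrict T)} (f : X ⟶ Y) (α : S) :
    extObj X α ⟶ extObj Y α :=
  if h : α ∈ T then (extIso X α h).hom ≫ restrictHom f α h ≫ (extIso Y α h).inv else 0

lemma extHom_of_mem {X Y : ConfObj (D.restrict T)} (f : X ⟶ Y) (α : S) (h : α ∈ T) :
    extHom f α = (extIso X α h).hom ≫ restrictHom f α h ≫ (extIso Y α h).inv :=
  dif_pos h

variable (T) in
/-- The extension by zero of the restriction of `Y` has the same components as `Y` in `T`. -/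
noncomputable def extResIso (Y : ConfObj D) (α : S) (h : α ∈ T) :
    extObj ((resF D T).obj Y) α ≅ Y.F α :=
  extIso ((resF D T).obj Y) α h

lemma extσ_resF (Y : ConfObj D) {α β : S} (h : β ≤ α) (hα : α ∈ T) (hβ : β ∈ T) :
    extσ ((resF D T).obj Y) h =
      (D.φ h).map (extResIso T Y α hα).hom ≫ Y.σ h ≫ (extResIso T Y β hβ).inv :=
  extσ_of_mem _ h hα hβ

lemma extHom_resF {Y Z : ConfObj D} (f : Y ⟶ Z) (α : S) (hα : α ∈ T) :
    extHom ((resF D T).map f) α = (extResIso T Y α hα).hom ≫ f.f α ≫ (extResIso T Z α hα).inv :=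
  extHom_of_mem _ α hα

open Classical in
variable (T) in
/-- The component at `α` of the inclusion into `Y` of the extension by zero of its restriction. -/
noncomputable def extResHom (Y : ConfObj D) (α : S) :
    extObj ((resF D T).obj Y) α ⟶ Y.F α :=
  if h : α ∈ T then (extResIso T Y α h).hom else 0

lemma extResHom_of_mem (Y : ConfObj D) (α : S) (h : α ∈ T) :
    extResHom T Y α = (extResIso T Y α h).hom :=
  dif_pos h

open Classical in
variable (T) in
/-- The component at `α` of the projection from `Y` to the extension by zero of its restriction. -/
noncomputable def extResInv (Y : ConfObj D) (α : S) :
    Y.F α ⟶ extObj ((resF D T).obj Y) α :=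
  if h : α ∈ T then (extResIso T Y α h).inv else 0

lemma extResInv_of_mem (Y : ConfObj D) (α : S) (h : α ∈ T) :
    extResInv T Y α = (extResIso T Y α h).inv :=
  dif_pos h

variable [∀ {α β : S} (h : β ≤ α), PreservesFiniteColimits (D.φ h)]

variable (D) in
lemma PosetDiagram.isZero_φ_obj {α β : S} (h : β ≤ α) {X : D.C α} (hX : IsZero X) :
    IsZero ((D.φ h).obj X) :=
  (D.φ h).map_isZero hX

variable (D T) in
/-- Extension by zero from a convex subset of the poset. -/
noncomputable def extZero [hT : T.OrdConnected] : ConfObj (D.restrict T) ⥤ ConfObj D where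
  obj X :=
    { F := extObj X
      σ := fun h => extσ X h
      σ_refl := fun α => by
        by_cases hα : α ∈ T
        · rw [extσ_of_mem X _ hα hα, D.φ_refl_map, restrictσ_refl]
          simp
        · exact (isZero_extObj X α hα).eq_of_tgt _ _
      σ_trans := fun {α β γ} h₁ h₂ => by
        by_cases hα : α ∈ T
        · by_cases hγ : γ ∈ T
          · have hβ : β ∈ T := hT.out hγ hα ⟨h₂, h₁⟩
            rw [extσ_of_mem X _ hα hγ, extσ_of_mem X _ hα hβ, extσ_of_mem X _ hβ hγ,
              restrictσ_trans X h₁ h₂ hα hβ hγ, D.φ_trans_map h₁ h₂]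
            simp only [Functor.map_comp, Category.assoc, eqToHom_trans_assoc, eqToHom_refl,
              Category.id_comp]
            rw [← Functor.map_comp_assoc _ (extIso X β hβ).inv, Iso.inv_hom_id,
              CategoryTheory.Functor.map_id, Category.id_comp]
          · exact (isZero_extObj X γ hγ).eq_of_tgt _ _
        · exact (D.isZero_φ_obj _ (isZero_extObj X α hα)).eq_of_src _ _ }
  map {X Y} f :=
    { f := extHom f
      comm := fun {α β} h => by
        by_cases hα : α ∈ T
        · by_cases hβ : β ∈ T
          · dsimp only
            rw [extσ_of_mem X _ hα hβ, extσ_of_mem Y _ hα hβ, extHom_of_mem f α hα,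
              extHom_of_mem f β hβ]
            simp only [Functor.map_comp, Category.assoc, Iso.inv_hom_id_assoc]
            rw [← Functor.map_comp_assoc _ (extIso Y α hα).inv, Iso.inv_hom_id,
              CategoryTheory.Functor.map_id, Category.id_comp, ← Category.assoc (restrictσ X h hα hβ),
              ← restrictHom_comm, Category.assoc]
          · exact (isZero_extObj Y β hβ).eq_of_tgt _ _
        · exact (D.isZero_φ_obj _ (isZero_extObj X α hα)).eq_of_src _ _ }
  map_id X := by
    apply ConfHom.ext
    funext α
    by_cases hα : α ∈ T
    · exact (extHom_of_mem _ α hα).trans (by rw [restrictHom_id]; simp)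
    · exact (isZero_extObj X α hα).eq_of_tgt _ _
  map_comp {X Y Z} f g := by
    apply ConfHom.ext
    funext α
    by_cases hα : α ∈ T
    · rw [conf_comp_f]
      dsimp only
      rw [extHom_of_mem _ α hα, extHom_of_mem _ α hα, extHom_of_mem _ α hα, restrictHom_comp]
      simp
    · exact (isZero_extObj Z α hα).eq_of_tgt _ _

variable (D T) in
/-- Restricting the extension by zero gives back the original object. -/
noncomputable def extZeroCompResF [T.OrdConnected] : extZero D T ⋙ resF D T ≅ 𝟭 _ where
  hom :=
    { app := fun X =>
        { f := fun t => (extIso X t.1 t.2).hom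
          comm := fun {α β} h => by
            have : (D.φ h).map (extIso X α.1 α.2).hom ≫ restrictσ X h α.2 β.2 =
                extσ X h ≫ (extIso X β.1 β.2).hom := by
              rw [extσ_of_mem X h α.2 β.2]
              simp
            exact this }
      naturality := fun X Y f => by
        apply ConfHom.ext
        funext t
        have : extHom f t.1 ≫ (extIso Y t.1 t.2).hom =
            (extIso X t.1 t.2).hom ≫ restrictHom f t.1 t.2 := by
          rw [extHom_of_mem f t.1 t.2]
          simp
        exact this }
  inv :=
    { app := fun X =>
        { f := fun t => (extIso X t.1 t.2).inv
          comm := fun {α β} h => by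
            have : (D.φ h).map (extIso X α.1 α.2).inv ≫ extσ X h =
                restrictσ X h α.2 β.2 ≫ (extIso X β.1 β.2).inv := by
              rw [extσ_of_mem X h α.2 β.2, ← Functor.map_comp_assoc]
              simp
            exact this }
      naturality := fun X Y f => by
        apply ConfHom.ext
        funext t
        have : restrictHom f t.1 t.2 ≫ (extIso Y t.1 t.2).inv =
            (extIso X t.1 t.2).inv ≫ extHom f t.1 := by
          rw [extHom_of_mem f t.1 t.2]
          simp
        exact this }
  hom_inv_id := by
    ext X
    exact ConfHom.ext (funext fun t => (extIso X t.1 t.2).hom_inv_id)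
  inv_hom_id := by
    ext X
    exact ConfHom.ext (funext fun t => (extIso X t.1 t.2).inv_hom_id)

variable (D) in
/-- Extension by zero from an open subset is left adjoint to restriction. -/
noncomputable def extZeroAdjunction (hT : IsLowerSet T) [T.OrdConnected] :
    extZero D T ⊣ resF D T where
  unit := (extZeroCompResF D T).inv
  counit :=
    { app := fun Y =>
        { f := extResHom T Y
          comm := fun {α β} h => by
            by_cases hα : α ∈ T
            · have hβ := hT h hα
              have : (D.φ h).map (extResHom T Y α) ≫ Y.σ h =
                  extσ ((resF D T).obj Y) h ≫ extResHom T Y β := by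
                rw [extResHom_of_mem Y α hα, extσ_resF Y h hα hβ, extResHom_of_mem Y β hβ]
                simp
              exact this
            · exact (D.isZero_φ_obj _ (isZero_extObj _ α hα)).eq_of_src _ _ }
      naturality := fun Y Z f => by
        apply ConfHom.ext
        funext α
        by_cases hα : α ∈ T
        · have : extHom ((resF D T).map f) α ≫ extResHom T Z α = extResHom T Y α ≫ f.f α := by
            rw [extHom_resF f α hα, extResHom_of_mem _ α hα, extResHom_of_mem _ α hα]
            simp
          exact this
        · exact (isZero_extObj _ α hα).eq_of_src _ _ }
  left_triangle_components X := by
    apply ConfHom.ext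
    funext α
    by_cases hα : α ∈ T
    · have h₁ : extHom ((extZeroCompResF D T).inv.app X) α =
          (extResIso T ((extZero D T).obj X) α hα).inv :=
        (extHom_of_mem _ α hα).trans (Iso.hom_inv_id_assoc (extIso X α hα) _)
      exact (congrArg₂ (· ≫ ·) h₁ (extResHom_of_mem _ α hα)).trans
        (extResIso T ((extZero D T).obj X) α hα).inv_hom_id
    · exact (isZero_extObj _ α hα).eq_of_src _ _
  right_triangle_components Y := by
    apply ConfHom.ext
    funext t
    exact (congrArg ((extResIso T Y t.1 t.2).inv ≫ ·) (extResHom_of_mem Y t.1 t.2)).trans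
      (extResIso T Y t.1 t.2).inv_hom_id

variable (D) in
/-- Extension by zero from a closed subset is right adjoint to restriction. -/
noncomputable def resFAdjunction (hT : IsUpperSet T) [T.OrdConnected] :
    resF D T ⊣ extZero D T where
  counit := (extZeroCompResF D T).hom
  unit :=
    { app := fun Y =>
        { f := extResInv T Y
          comm := fun {α β} h => by
            by_cases hβ : β ∈ T
            · have hα := hT h hβ
              have : (D.φ h).map (extResInv T Y α) ≫ extσ ((resF D T).obj Y) h =
                  Y.σ h ≫ extResInv T Y β := by
                rw [extResInv_of_mem Y α hα, extσ_resF Y h hα hβ, extResInv_of_mem Y β hβ,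
                  ← Functor.map_comp_assoc]
                simp
              exact this
            · exact (isZero_extObj _ β hβ).eq_of_tgt _ _ }
      naturality := fun Y Z f => by
        apply ConfHom.ext
        funext α
        by_cases hα : α ∈ T
        · have : f.f α ≫ extResInv T Z α = extResInv T Y α ≫ extHom ((resF D T).map f) α := by
            rw [extHom_resF f α hα, extResInv_of_mem _ α hα, extResInv_of_mem _ α hα]
            simp
          exact this
        · exact (isZero_extObj _ α hα).eq_of_tgt _ _ }
  left_triangle_components Y := by
    apply ConfHom.ext
    funext t
    exact (congrArg (· ≫ (extResIso T Y t.1 t.2).hom) (extResInv_of_mem Y t.1 t.2)).trans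
      (extResIso T Y t.1 t.2).inv_hom_id
  right_triangle_components X := by
    apply ConfHom.ext
    funext α
    by_cases hα : α ∈ T
    · have h₁ : extHom ((extZeroCompResF D T).hom.app X) α =
          (extResIso T ((extZero D T).obj X) α hα).hom := by
        refine (extHom_of_mem _ α hα).trans ?_
        exact congrArg ((extResIso T ((extZero D T).obj X) α hα).hom ≫ ·)
          (extIso X α hα).hom_inv_id |>.trans (Category.comp_id _)
      exact (congrArg₂ (· ≫ ·) (extResInv_of_mem _ α hα) h₁).trans
        (extResIso T ((extZero D T).obj X) α hα).inv_hom_id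
    · exact (isZero_extObj _ α hα).eq_of_tgt _ _

instance (t : T) : Abelian ((D.restrict T).C t) := inferInstanceAs (Abelian (D.C t.1))

instance {s t : T} (h : s ≤ t) : PreservesFiniteColimits ((D.restrict T).φ h) :=
  inferInstanceAs (PreservesFiniteColimits (D.φ (show s.1 ≤ t.1 from h)))

instance preservesFiniteLimits_resF : PreservesFiniteLimits (resF D T) :=
  preservesFiniteLimits_of_comp_evalF _ fun t =>
    inferInstanceAs (PreservesFiniteLimits (evalF D t.1))

instance preservesFiniteColimits_resF : PreservesFiniteColimits (resF D T) :=
  preservesFiniteColimits_of_comp_evalF _ fun t =>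
    inferInstanceAs (PreservesFiniteColimits (evalF D t.1))

variable (D) in
/-- The evaluation functor of the restricted category, with values in `D.C α`. -/
def restrictEval (α : S) (hα : α ∈ T) : ConfObj (D.restrict T) ⥤ D.C α :=
  evalF (D.restrict T) ⟨α, hα⟩

instance (α : S) (hα : α ∈ T) : PreservesFiniteLimits (restrictEval D α hα) :=
  evalF_preservesFiniteLimits (D := D.restrict T) ⟨α, hα⟩

instance (α : S) (hα : α ∈ T) : PreservesFiniteColimits (restrictEval D α hα) :=
  evalF_preservesFiniteColimits (D := D.restrict T) ⟨α, hα⟩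

variable (D) in
/-- The components of the extension by zero in `T`. -/
noncomputable def extZeroCompEvalF [T.OrdConnected] (α : S) (hα : α ∈ T) :
    extZero D T ⋙ evalF D α ≅ restrictEval D α hα :=
  NatIso.ofComponents (fun X => extIso X α hα) fun {X Y} f => by
    have : extHom f α ≫ (extIso Y α hα).hom = (extIso X α hα).hom ≫ restrictHom f α hα := by
      rw [extHom_of_mem f α hα]
      simp
    exact this

variable (D) in
lemma isZero_extZero_comp_evalF [T.OrdConnected] (α : S) (hα : α ∉ T) :
    IsZero (extZero D T ⋙ evalF D α) :=
  Functor.isZero _ fun X => isZero_extObj X α hα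

instance preservesFiniteLimits_extZero [T.OrdConnected] : PreservesFiniteLimits (extZero D T) :=
  preservesFiniteLimits_of_comp_evalF _ fun α => by
    by_cases hα : α ∈ T
    · exact preservesFiniteLimits_of_natIso (extZeroCompEvalF D α hα).symm
    · exact ⟨fun J _ _ =>
        Functor.preservesLimitsOfShape_of_isZero _ (isZero_extZero_comp_evalF D α hα) J⟩

instance preservesFiniteColimits_extZero [T.OrdConnected] :
    PreservesFiniteColimits (extZero D T) :=
  preservesFiniteColimits_of_comp_evalF _ fun α => by
    by_cases hα : α ∈ T
    · exact preservesFiniteColimits_of_natIso (extZeroCompEvalF D α hα).symm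
    · exact ⟨fun J _ _ =>
        Functor.preservesColimitsOfShape_of_isZero _ (isZero_extZero_comp_evalF D α hα) J⟩

instance [T.OrdConnected] (hT : IsLowerSet T) : IsIso (extZeroAdjunction D hT).unit :=
  inferInstanceAs (IsIso (extZeroCompResF D T).inv)

instance [T.OrdConnected] (hT : IsUpperSet T) : IsIso (resFAdjunction D hT).counit :=
  inferInstanceAs (IsIso (extZeroCompResF D T).hom)

end Extension

section

variable [∀ α, Abelian (D.C α)] [∀ {α β : S} (h : β ≤ α), PreservesFiniteColimits (D.φ h)]

lemma isZero_of_components {X : ConfObj D} (h : ∀ α, IsZero (X.F α)) : IsZero X where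
  unique_to _ := ⟨
    { default := ⟨fun α => (h α).to_ _, fun _ => (D.isZero_φ_obj _ (h _)).eq_of_src _ _⟩
      uniq := fun _ => ConfHom.ext (funext fun α => (h α).eq_of_src _ _) }⟩
  unique_from _ := ⟨
    { default := ⟨fun α => (h α).from_ _, fun _ => (h _).eq_of_tgt _ _⟩
      uniq := fun _ => ConfHom.ext (funext fun α => (h α).eq_of_tgt _ _) }⟩

lemma isZero_iff_components [HasZeroMorphisms (ConfObj D)]
    [HasZeroObject (ConfObj D)] (X : ConfObj D) : IsZero X ↔ ∀ α, IsZero (X.F α) :=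
  ⟨fun h α => (evalF D α).map_isZero h, isZero_of_components⟩

lemma isZero_resF_obj_iff {T : Set S}
    [HasZeroMorphisms (ConfObj (D.restrict T))] [HasZeroObject (ConfObj (D.restrict T))]
    (X : ConfObj D) : IsZero ((resF D T).obj X) ↔ ∀ α, α ∈ T → IsZero (X.F α) :=
  (isZero_iff_components _).trans
    ⟨fun h α hα => h ⟨α, hα⟩, fun h t => h t.1 t.2⟩

end

end ConfigurationCategories

lemma additive_of_preservesFiniteLimits {A : Type*} {B : Type*} [Category* A] [Category* B]
    [Abelian A] [Abelian B] (F : A ⥤ B) [PreservesFiniteLimits F] : F.Additive :=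
  Functor.additive_of_preserves_binary_products F

instance (CS : ConfigScheme S) (SD : SheafData.{v, u}) (α : S) :
    Abelian ((CS.diagram SD).C α) :=
  SD.ab (CS.X α)

instance (CS : ConfigScheme S) (SD : SheafData.{v, u}) {α β : S} (h : β ≤ α) :
    PreservesFiniteColimits ((CS.diagram SD).φ h) :=
  SD.pull_rightExact (CS.f h)

/-- **Statement 10** (Proposition 3.6): let `X/S` be a smooth configuration scheme and
`U ⊆ S` open (a lower set) with closed complement `Z = S \ U`.  Then:
(i) the extension-by-zero functors `j_! : D^b(coh(X/U)) ⥤ D^b(coh(X/S))` and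
`i_* : D^b(coh(X/Z)) ⥤ D^b(coh(X/S))` are fully faithful (where the abelian-level `j₀` is
the left adjoint of the restriction `j^*` and `i₀` is the right adjoint of the restriction
`i^*`);
(ii) `D^b(coh(X/Z))` is the right orthogonal of `D^b(coh(X/U))` in `D^b(coh(X/S))`
(identifying these subcategories with the complexes whose cohomologies are supported in
`Z`, resp. `U`);
(iii) `D^b(coh(X/U))` is right-admissible: every `F` sits in an exact triangle
`F_U → F → F_Z` with `F_U` supported in `U` and `F_Z` in the right orthogonal. -/
theorem Db_coh_open_closed_decomposition
    (S : Type) [PartialOrder S] [Fintype S]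
    (CS : ConfigScheme S) (hsm : CS.Smooth) (SD : SheafData.{v, u})
    (U : Set S) (hU : IsLowerSet U)
    [Abelian (cohConf CS SD)]
    [Abelian (ConfObj ((CS.diagram SD).restrict U))]
    [Abelian (ConfObj ((CS.diagram SD).restrict Uᶜ))]
    [HasDerivedCategory.{w} (cohConf CS SD)]
    [HasDerivedCategory.{w} (ConfObj ((CS.diagram SD).restrict U))]
    [HasDerivedCategory.{w} (ConfObj ((CS.diagram SD).restrict Uᶜ))] :
    -- (i):
    (∃ (i₀ : ConfObj ((CS.diagram SD).restrict Uᶜ) ⥤ cohConf CS SD)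
      (j₀ : ConfObj ((CS.diagram SD).restrict U) ⥤ cohConf CS SD)
      (istar : Db (ConfObj ((CS.diagram SD).restrict Uᶜ)) ⥤ Db (cohConf CS SD))
      (jshriek : Db (ConfObj ((CS.diagram SD).restrict U)) ⥤ Db (cohConf CS SD)),
      Nonempty (resF (CS.diagram SD) Uᶜ ⊣ i₀) ∧
      Nonempty (j₀ ⊣ resF (CS.diagram SD) U) ∧
      Nonempty (toDb (ConfObj ((CS.diagram SD).restrict Uᶜ)) ⋙ istar ≅
        i₀ ⋙ toDb (cohConf CS SD)) ∧
      Nonempty (toDb (ConfObj ((CS.diagram SD).restrict U)) ⋙ jshriek ≅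
        j₀ ⋙ toDb (cohConf CS SD)) ∧
      istar.Full ∧ istar.Faithful ∧ jshriek.Full ∧ jshriek.Faithful) ∧
    -- (ii):
    (∀ X : Db (cohConf CS SD),
      (∀ B : Db (cohConf CS SD),
        (∀ (n : ℤ) (α : S), α ∉ U →
          IsZero (((DerivedCategory.homologyFunctor (cohConf CS SD) n).obj B.obj).F α)) →
        Subsingleton (B ⟶ X)) ↔
      (∀ (n : ℤ) (α : S), α ∈ U →
        IsZero (((DerivedCategory.homologyFunctor (cohConf CS SD) n).obj X.obj).F α))) ∧
    -- (iii):
    (∀ X : Db (cohConf CS SD),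
      ∃ (B C : Db (cohConf CS SD)) (f : B.obj ⟶ X.obj) (g : X.obj ⟶ C.obj)
        (h : C.obj ⟶ B.obj⟦(1 : ℤ)⟧),
        (Triangle.mk f g h ∈ distTriang (DerivedCategory (cohConf CS SD))) ∧
        (∀ (n : ℤ) (α : S), α ∉ U →
          IsZero (((DerivedCategory.homologyFunctor (cohConf CS SD) n).obj B.obj).F α)) ∧
        (∀ B' : Db (cohConf CS SD),
          (∀ (n : ℤ) (α : S), α ∉ U →
            IsZero (((DerivedCategory.homologyFunctor (cohConf CS SD) n).obj B'.obj).F α)) →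
          Subsingleton (B' ⟶ C))) := by

  let D := CS.diagram SD
  have hZ : IsUpperSet Uᶜ := hU.compl
  have := hU.ordConnected
  have := hZ.ordConnected
  have := additive_of_preservesFiniteLimits (extZero D U)
  have := additive_of_preservesFiniteLimits (extZero D Uᶜ)
  have := additive_of_preservesFiniteLimits (resF D U)
  have := additive_of_preservesFiniteLimits (resF D Uᶜ)
  let adjU : extZero D U ⊣ resF D U := extZeroAdjunction D hU
  let adjZ : resF D Uᶜ ⊣ extZero D Uᶜ := resFAdjunction D hZ
  have : IsIso adjU.unit := inferInstanceAs (IsIso (extZeroAdjunction D hU).unit)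
  have : IsIso adjZ.counit := inferInstanceAs (IsIso (resFAdjunction D hZ).counit)
  have fullyFaithfulU := (mapDerivedCategoryAdjunction adjU).fullyFaithfulLOfIsIsoUnit
  have := fullyFaithfulU.full
  have := fullyFaithfulU.faithful
  have fullyFaithfulZ := (mapDerivedCategoryAdjunction adjZ).fullyFaithfulROfIsIsoCounit
  have := fullyFaithfulZ.full
  have := fullyFaithfulZ.faithful
  obtain ⟨orthogonal, admissible⟩ := Db_orthogonal_and_admissible adjU (resF D Uᶜ)
    (fun X => (isZero_resF_obj_iff _).2 fun α hα => isZero_extObj X α hα)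
    (fun {Y} h₁ h₂ => isZero_of_components fun α => by
      by_cases hα : α ∈ U
      · exact (isZero_resF_obj_iff Y).1 h₁ α hα
      · exact (isZero_resF_obj_iff Y).1 h₂ α hα)
  simp only [isZero_resF_obj_iff, Set.mem_compl_iff] at orthogonal admissible
  refine ⟨⟨extZero D Uᶜ, extZero D U, mapDb (extZero D Uᶜ), mapDb (extZero D U), ⟨adjZ⟩, ⟨adjU⟩,
    ⟨toDbCompMapDb _⟩, ⟨toDbCompMapDb _⟩, inferInstance, inferInstance, inferInstance,
    inferInstance⟩, orthogonal, fun X => ?_⟩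
  obtain ⟨B, C, f, g, h, hT, hB, hC⟩ := admissible X
  exact ⟨B, C, f, g, h, hT, hB, (orthogonal C).2 hC⟩
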